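/- With the noisy harmonic oscillator setup (γ, ω, σ, σ̄₁, σ̄₂ > 0; F = [[0,1],[−ω²,−γ]]; Σ = [[0,0],[0,σ]]; Q₀ = diag(σ̄₁², σ̄₂²); R(t) = ∫₀ᵗ e^{sF} Σ Σᵀ e^{sFᵀ} ds; Q(t) = e^{tF} Q₀ e^{tFᵀ} + R(t); σ_* = σ²/(2γω²)), assume the underdamped condition γ² < 4ω² and that both initial variances are below the stationary ones: σ̄₁² < σ_* and σ̄₂² < ω² σ_*. Then t ↦ det Q(t) is strictly increasing on (0, ∞); equivalently, the Gibbs entropy H_G(t) = 1 + log(2π) + (1/2) log det Q(t) of the Gaussian solution is strictly increasing. -/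

import Mathlib

open MeasureTheory Real Filter Matrix Set

section MatrixExponential

attribute [local instance] Matrix.linftyOpNormedRing Matrix.linftyOpNormedAlgebra

/-- Entrywise derivative of `t ↦ exp (t • F)`, with `F` on the right. -/
lemma hasDerivAt_exp_smul_apply (F : Matrix (Fin 2) (Fin 2) ℝ) (t : ℝ) (i j : Fin 2) :
    HasDerivAt (fun t : ℝ => NormedSpace.exp (t • F) i j) ((NormedSpace.exp (t • F) * F) i j) t :=
  hasDerivAt_pi.1 (hasDerivAt_pi.1 (hasDerivAt_exp_smul_const (𝕂 := ℝ) F t) i) j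

end MatrixExponential

/-- The flow of the damped oscillator is determined by its first row `(a, b)`. -/
lemma exists_exp_smul_oscillator_eq (γ ω : ℝ) :
    ∃ a b : ℝ → ℝ,
      (∀ t : ℝ, NormedSpace.exp (t • !![0, 1; -ω ^ 2, -γ]) =
        !![a t, b t; -ω ^ 2 * b t, a t - γ * b t]) ∧
      a 0 = 1 ∧ b 0 = 0 ∧
      (∀ t, HasDerivAt a (-ω ^ 2 * b t) t) ∧ (∀ t, HasDerivAt b (a t - γ * b t) t) ∧
      ∀ t, a t ≠ 0 ∨ b t ≠ 0 := by
  set F : Matrix (Fin 2) (Fin 2) ℝ := !![0, 1; -ω ^ 2, -γ] with hF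
  have hmatrix (t : ℝ) : NormedSpace.exp (t • F) =
      !![NormedSpace.exp (t • F) 0 0, NormedSpace.exp (t • F) 0 1;
        -ω ^ 2 * NormedSpace.exp (t • F) 0 1,
        NormedSpace.exp (t • F) 0 0 - γ * NormedSpace.exp (t • F) 0 1] := by
    have hcomm : NormedSpace.exp (t • F) * F = F * NormedSpace.exp (t • F) :=
      ((Commute.refl F).smul_left t).exp_left.eq
    generalize NormedSpace.exp (t • F) = E at hcomm ⊢
    have h00 := congrFun (congrFun hcomm 0) 0
    have h01 := congrFun (congrFun hcomm 0) 1
    simp [hF, Matrix.mul_apply, Fin.sum_univ_two] at h00 h01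
    ext i j
    fin_cases i <;> fin_cases j <;> simp <;> linarith
  refine ⟨fun t => NormedSpace.exp (t • F) 0 0, fun t => NormedSpace.exp (t • F) 0 1,
    hmatrix, by simp, by simp, fun t => ?_, fun t => ?_, fun t => ?_⟩
  · convert hasDerivAt_exp_smul_apply F t 0 0 using 1
    simp [hF, Matrix.mul_apply, Fin.sum_univ_two]
    ring
  · convert hasDerivAt_exp_smul_apply F t 0 1 using 1
    simp [hF, Matrix.mul_apply, Fin.sum_univ_two]
    ring
  · by_contra! h
    have hdet := (Matrix.isUnit_iff_isUnit_det _).1 (Matrix.isUnit_exp (t • F))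
    rw [hmatrix t, h.1, h.2] at hdet
    simp at hdet

/-- Underdamped noisy harmonic oscillator (`γ² < 4ω²`): if both initial variances are below
the stationary ones (`σ̄₁² < σ_*`, `σ̄₂² < ω²σ_*`), then `det Q(t)` is strictly increasing on
`(0, ∞)`; equivalently the Gibbs entropy `H_G(t) = 1 + log(2π) + (1/2) log det Q(t)` is
strictly increasing. -/
theorem noisy_ho_underdamped_gibbs_increasing (γ ω σ σ₁ σ₂ : ℝ)
    (hγ : 0 < γ) (hω : 0 < ω) (hσ : 0 < σ) (hσ₁ : 0 < σ₁) (hσ₂ : 0 < σ₂)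
    (hunder : γ ^ 2 < 4 * ω ^ 2) :
    ∀ F Sg Q₀ : Matrix (Fin 2) (Fin 2) ℝ,
      F = !![0, 1; -ω ^ 2, -γ] → Sg = !![0, 0; 0, σ] → Q₀ = !![σ₁ ^ 2, 0; 0, σ₂ ^ 2] →
    ∀ R : ℝ → Matrix (Fin 2) (Fin 2) ℝ,
      R = (fun t => Matrix.of (fun i j =>
        ∫ s in (0 : ℝ)..t,
          (NormedSpace.exp (s • F) * (Sg * Sgᵀ) * NormedSpace.exp (s • Fᵀ)) i j)) →
    ∀ Q : ℝ → Matrix (Fin 2) (Fin 2) ℝ,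
      Q = (fun t => NormedSpace.exp (t • F) * Q₀ * NormedSpace.exp (t • Fᵀ) + R t) →
    ∀ sstar : ℝ, sstar = σ ^ 2 / (2 * γ * ω ^ 2) →
    σ₁ ^ 2 < sstar → σ₂ ^ 2 < ω ^ 2 * sstar →
      StrictMonoOn (fun t => (Q t).det) (Ioi 0) ∧
        StrictMonoOn (fun t => 1 + Real.log (2 * Real.pi) + (1 / 2) * Real.log (Q t).det)
          (Ioi 0) := by
  rintro F Sg Q₀ hF rfl rfl R rfl Q rfl s hs h₁ h₂
  obtain ⟨a, b, hexp, ha0, hb0, ha, hb, hab⟩ := exists_exp_smul_oscillator_eq γ ω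
  have hσs : σ ^ 2 = 2 * γ * ω ^ 2 * s := by
    rw [hs]
    field_simp
  have hexpT (t : ℝ) : NormedSpace.exp (t • Fᵀ) = !![a t, -ω ^ 2 * b t; b t, a t - γ * b t] := by
    rw [← Matrix.transpose_smul, Matrix.exp_transpose, hF, hexp]
    ext i j
    fin_cases i <;> fin_cases j <;> rfl
  have hca : Continuous a := continuous_iff_continuousAt.2 fun t => (ha t).continuousAt
  have hcb : Continuous b := continuous_iff_continuousAt.2 fun t => (hb t).continuousAt
  have h_integral_00 (t : ℝ) : ∫ u in (0 : ℝ)..t, σ ^ 2 * b u ^ 2 =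
      s - s * a t ^ 2 - ω ^ 2 * s * b t ^ 2 := by
    rw [intervalIntegral.integral_eq_sub_of_hasDerivAt
      (f := fun t => s - s * a t ^ 2 - ω ^ 2 * s * b t ^ 2)]
    · simp [ha0, hb0]
    · intro u _
      refine (((((ha u).pow 2).const_mul s).const_sub s).sub
        (((hb u).pow 2).const_mul (ω ^ 2 * s))).congr_deriv ?_
      rw [hσs]
      ring
    · exact Continuous.intervalIntegrable (by fun_prop) _ _
  have h_integral_01 (t : ℝ) : ∫ u in (0 : ℝ)..t, σ ^ 2 * (b u * (a u - γ * b u)) =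
      γ * ω ^ 2 * s * b t ^ 2 := by
    rw [intervalIntegral.integral_eq_sub_of_hasDerivAt
      (f := fun t => γ * ω ^ 2 * s * b t ^ 2)]
    · simp [hb0]
    · intro u _
      refine (((hb u).pow 2).const_mul (γ * ω ^ 2 * s)).congr_deriv ?_
      rw [hσs]
      ring
    · exact Continuous.intervalIntegrable (by fun_prop) _ _
  have h_integral_11 (t : ℝ) : ∫ u in (0 : ℝ)..t, σ ^ 2 * (a u - γ * b u) ^ 2 =
      ω ^ 2 * s - ω ^ 4 * s * b t ^ 2 - ω ^ 2 * s * (a t - γ * b t) ^ 2 := by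
    rw [intervalIntegral.integral_eq_sub_of_hasDerivAt
      (f := fun t => ω ^ 2 * s - ω ^ 4 * s * b t ^ 2 - ω ^ 2 * s * (a t - γ * b t) ^ 2)]
    · simp [ha0, hb0]
    · intro u _
      refine (((((hb u).pow 2).const_mul (ω ^ 4 * s)).const_sub (ω ^ 2 * s)).sub
        ((((ha u).sub ((hb u).const_mul γ)).pow 2).const_mul (ω ^ 2 * s))).congr_deriv ?_
      simp only [Pi.sub_apply]
      rw [hσs]
      ring
    · exact Continuous.intervalIntegrable (by fun_prop) _ _
  -- `Q = R_* - P`, where `P = exp (t • F) * (R_* - Q₀) * exp (t • Fᵀ)` has these entries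
  set p : ℝ → ℝ := fun t => (s - σ₁ ^ 2) * a t ^ 2 + (ω ^ 2 * s - σ₂ ^ 2) * b t ^ 2 with hp
  set q : ℝ → ℝ := fun t => -ω ^ 2 * (s - σ₁ ^ 2) * (a t * b t) +
    (ω ^ 2 * s - σ₂ ^ 2) * (b t * (a t - γ * b t)) with hq
  set r : ℝ → ℝ := fun t => (s - σ₁ ^ 2) * ω ^ 4 * b t ^ 2 +
    (ω ^ 2 * s - σ₂ ^ 2) * (a t - γ * b t) ^ 2 with hr
  have hdet (t : ℝ) : (NormedSpace.exp (t • F) * !![σ₁ ^ 2, 0; 0, σ₂ ^ 2] *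
      NormedSpace.exp (t • Fᵀ) + Matrix.of (fun i j => ∫ u in (0 : ℝ)..t,
        (NormedSpace.exp (u • F) * (!![0, 0; 0, σ] * !![0, 0; 0, σ]ᵀ) *
          NormedSpace.exp (u • Fᵀ)) i j)).det =
      (s - p t) * (ω ^ 2 * s - r t) - q t ^ 2 := by
    have hR : (Matrix.of (fun i j => ∫ u in (0 : ℝ)..t,
        (NormedSpace.exp (u • F) * (!![0, 0; 0, σ] * !![0, 0; 0, σ]ᵀ) *
          NormedSpace.exp (u • Fᵀ)) i j)) =
        !![s - s * a t ^ 2 - ω ^ 2 * s * b t ^ 2, γ * ω ^ 2 * s * b t ^ 2;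
          γ * ω ^ 2 * s * b t ^ 2,
          ω ^ 2 * s - ω ^ 4 * s * b t ^ 2 - ω ^ 2 * s * (a t - γ * b t) ^ 2] := by
      have hnoise : !![0, 0; 0, σ] * !![0, 0; 0, σ]ᵀ = !![0, 0; 0, σ ^ 2] := by
        ext i j
        fin_cases i <;> fin_cases j <;> simp [Matrix.mul_apply, Fin.sum_univ_two, sq]
      simp only [hexpT, hnoise]
      simp only [hF, hexp]
      ext i j
      fin_cases i <;> fin_cases j
      · refine Eq.trans (intervalIntegral.integral_congr fun u _ => ?_) (h_integral_00 t)
        simp [Matrix.mul_apply, Fin.sum_univ_two]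
        ring
      · refine Eq.trans (intervalIntegral.integral_congr fun u _ => ?_) (h_integral_01 t)
        simp [Matrix.mul_apply, Fin.sum_univ_two]
        ring
      · refine Eq.trans (intervalIntegral.integral_congr fun u _ => ?_) (h_integral_01 t)
        simp [Matrix.mul_apply, Fin.sum_univ_two]
        ring
      · refine Eq.trans (intervalIntegral.integral_congr fun u _ => ?_) (h_integral_11 t)
        simp [Matrix.mul_apply, Fin.sum_univ_two]
        ring
    rw [hR, hexpT, hF, hexp]
    simp [Matrix.det_fin_two, hp, hq, hr]
    ring
  simp only [hdet]
  have hderiv (t : ℝ) : HasDerivAt (fun t => (s - p t) * (ω ^ 2 * s - r t) - q t ^ 2)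
      (2 * γ * (r t * (s - p t) + q t ^ 2)) t := by
    have hd := (ha t).sub ((hb t).const_mul γ)
    have hp' := (((ha t).pow 2).const_mul (s - σ₁ ^ 2)).add
      (((hb t).pow 2).const_mul (ω ^ 2 * s - σ₂ ^ 2))
    have hq' := (((ha t).mul (hb t)).const_mul (-ω ^ 2 * (s - σ₁ ^ 2))).add
      (((hb t).mul hd).const_mul (ω ^ 2 * s - σ₂ ^ 2))
    have hr' := (((hb t).pow 2).const_mul ((s - σ₁ ^ 2) * ω ^ 4)).add
      ((hd.pow 2).const_mul (ω ^ 2 * s - σ₂ ^ 2))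
    refine (((hp'.const_sub s).mul (hr'.const_sub (ω ^ 2 * s))).sub (hq'.pow 2)).congr_deriv ?_
    simp [hp, hq, hr]
    ring
  have hp_lt {t : ℝ} (ht : 0 ≤ t) : 0 < s - p t := by
    have hR : 0 ≤ s - s * a t ^ 2 - ω ^ 2 * s * b t ^ 2 := by
      rw [← h_integral_00]
      exact intervalIntegral.integral_nonneg ht fun u _ => by positivity
    have hQ : 0 < σ₁ ^ 2 * a t ^ 2 + σ₂ ^ 2 * b t ^ 2 := by
      rcases hab t with h | h <;> positivity
    simp only [hp]
    linarith
  have hr_pos (t : ℝ) : 0 < r t := by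
    have hd₁ : 0 < s - σ₁ ^ 2 := sub_pos.2 h₁
    have hd₂ : 0 < ω ^ 2 * s - σ₂ ^ 2 := sub_pos.2 h₂
    by_cases hbt : b t = 0
    · have hat : a t ≠ 0 := (hab t).resolve_right (not_not.2 hbt)
      simp only [hr, hbt]
      simp
      positivity
    · simp only [hr]
      positivity
  have hmono : StrictMonoOn (fun t => (s - p t) * (ω ^ 2 * s - r t) - q t ^ 2) (Ici 0) := by
    refine strictMonoOn_of_deriv_pos (convex_Ici 0)
      (fun t _ => (hderiv t).continuousAt.continuousWithinAt) fun t ht => ?_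
    rw [interior_Ici] at ht
    rw [(hderiv t).deriv]
    have := hp_lt (mem_Ioi.1 ht).le
    have := hr_pos t
    positivity
  have hdet_pos {t : ℝ} (ht : 0 < t) : 0 < (s - p t) * (ω ^ 2 * s - r t) - q t ^ 2 := by
    refine lt_trans ?_ (hmono self_mem_Ici ht.le ht)
    simp [hp, hq, hr, ha0, hb0]
    positivity
  refine ⟨hmono.mono Ioi_subset_Ici_self, fun x hx y hy hxy => ?_⟩
  have := Real.log_lt_log (hdet_pos hx) (hmono (mem_Ioi.1 hx).le (mem_Ioi.1 hy).le hxy)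
  simp only
  linarith
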